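/- arXiv:math/0311287 — 4 statements merged into one kernel-verified Lean document; each statement's English description precedes it below -/
import Mathlib

section
/- Let K₆ be the splitting field over ℚ of the polynomial X³ + 3X − 2. Then: (1) the Galois group Gal(K₆/ℚ) is isomorphic to the symmetric group S₃; (2) K₆ contains a square root of −6 (i.e., K₆ contains the quadratic field ℚ(√-6)); and (3) every rational prime ramified in K₆ lies in {2, 3}. -/
open Polynomial

/-- K₆, the splitting field of X³ + 3X − 2 over ℚ. -/
noncomputable abbrev K6 : Type := Polynomial.SplittingField (X ^ 3 + 3 * X - 2 : ℚ[X])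

instance : NumberField K6 := ⟨⟩

open NumberField

/-- If `L = F(x)` with `x` integral over `R`, then `g'(x)` lies in the different of `S / R` for
every polynomial `g` over `R` vanishing at `x`. -/
theorem aeval_derivative_mem_differentIdeal_of_aeval_eq_zero (R F L : Type*) {S : Type*}
    [CommRing R] [Field F] [CommRing S] [Field L] [Algebra R F] [Algebra S L] [Algebra R S]
    [Algebra F L] [Algebra R L] [IsScalarTower R F L] [IsScalarTower R S L] [IsDomain R]
    [IsFractionRing R F] [FiniteDimensional F L] [Algebra.IsSeparable F L]
    [IsIntegralClosure S R L] [IsIntegrallyClosed R] [IsDedekindDomain S] [IsFractionRing S L]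
    [Module.IsTorsionFree R S] [Algebra.IsIntegral R S]
    {x : S} (hx : Algebra.adjoin F {algebraMap S L x} = ⊤) {g : R[X]} (hg : aeval x g = 0) :
    aeval x (derivative g) ∈ differentIdeal R S := by
  obtain ⟨h, rfl⟩ := minpoly.isIntegrallyClosed_dvd (Algebra.IsIntegral.isIntegral x) hg
  rw [derivative_mul, map_add, map_mul, map_mul, minpoly.aeval, zero_mul, add_zero]
  exact Ideal.mul_mem_right _ _ (aeval_derivative_mem_differentIdeal R F L x hx)

/-- A rational integer in the different of `K` is divisible by every prime dividing the
discriminant of `K`. -/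
theorem prime_dvd_of_dvd_discr_of_mem_differentIdeal {K : Type*} [Field K] [NumberField K]
    {n : ℤ} (hn : (n : 𝓞 K) ∈ differentIdeal ℤ (𝓞 K)) {p : ℕ} (hp : p.Prime)
    (h : (p : ℤ) ∣ discr K) : (p : ℤ) ∣ n := by
  have h1 : (discr K).natAbs ∣ n.natAbs ^ Module.finrank ℤ (𝓞 K) := by
    rw [← absNorm_differentIdeal K (𝓞 K)]
    have := Ideal.absNorm_dvd_absNorm_of_le ((Ideal.span_singleton_le_iff_mem _).2 hn)
    rw [Ideal.absNorm_span_singleton] at this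
    have h2 : Algebra.norm ℤ (n : 𝓞 K) = n ^ Module.finrank ℤ (𝓞 K) := by
      simpa [Module.finrank_eq_card_chooseBasisIndex] using
        Algebra.norm_algebraMap_of_basis (RingOfIntegers.basis K) n
    rwa [h2, Int.natAbs_pow] at this
  have h2 := (Int.natCast_dvd.1 h).trans h1
  exact Int.natCast_dvd.2 (hp.dvd_of_dvd_pow h2)

theorem natDegree_X_pow_three_add_three_mul_X_sub_two : (X ^ 3 + 3 * X - 2 : ℚ[X]).natDegree = 3 := by
  compute_degree!

theorem irreducible_cubic : Irreducible (X ^ 3 + 3 * X - 2 : ℚ[X]) := by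
  have hm : (X ^ 3 + 3 * X - 2 : ℤ[X]).Monic := by monicity!
  have hd : (X ^ 3 + 3 * X - 2 : ℤ[X]).natDegree = 3 := by compute_degree!
  have hi : Irreducible (X ^ 3 + 3 * X - 2 : ℤ[X]) := by
    rw [hm.irreducible_iff_roots_eq_zero_of_degree_le_three (by omega) (by omega)]
    refine Multiset.eq_zero_of_forall_notMem fun x hx => ?_
    have h := (mem_roots'.1 hx).2
    simp only [IsRoot.def, eval_sub, eval_add, eval_mul, eval_pow, eval_X, eval_ofNat] at h
    rcases le_or_gt x 0 with h0 | h0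
    · nlinarith [mul_nonneg (neg_nonneg.2 h0) (sq_nonneg x)]
    · have h1 : 1 ≤ x := h0
      nlinarith [pow_pos h0 3]
  simpa using (hm.irreducible_iff_irreducible_map_fraction_map (K := ℚ)).1 hi

/-- Viète's relations for the roots of `X³ + 3X - 2` in its splitting field. -/
theorem exists_roots_cubic : ∃ a b c : K6,
    (X ^ 3 + 3 * X - 2 : ℚ[X]).rootSet K6 = {a, b, c} ∧
    a + b + c = 0 ∧ a * b + b * c + a * c = 3 ∧ a * b * c = 2 := by
  have hs : ((X ^ 3 + 3 * X - 2 : ℚ[X]).map (algebraMap ℚ K6)).Splits :=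
    SplittingField.splits _
  have hm : (X ^ 3 + 3 * X - 2 : ℚ[X]).Monic := by monicity!
  have hcard := hs.natDegree_eq_card_roots
  rw [natDegree_map, natDegree_X_pow_three_add_three_mul_X_sub_two, eq_comm, Multiset.card_eq_three] at hcard
  obtain ⟨a, b, c, habc⟩ := hcard
  have hprod := hs.eq_prod_roots
  rw [habc, (hm.map _).leadingCoeff] at hprod
  have h (t : K6) : t ^ 3 + 3 * t - 2 = (t - a) * ((t - b) * (t - c)) := by
    simpa using congrArg (eval t) hprod
  refine ⟨a, b, c, ?_, ?_, ?_, ?_⟩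
  · ext x
    rw [mem_rootSet_of_ne hm.ne_zero]
    have : aeval x (X ^ 3 + 3 * X - 2 : ℚ[X]) = (x - a) * ((x - b) * (x - c)) := by
      rw [← h]
      simp only [map_sub, map_add, map_mul, map_pow, aeval_X, map_ofNat]
    rw [this]
    simp [sub_eq_zero]
  · linear_combination (1 / 2) * h 1 + (1 / 2) * h (-1) - h 0
  · linear_combination (-1 / 2) * h 1 + (1 / 2) * h (-1)
  · linear_combination h 0

theorem sq_discr_cubic {R : Type*} [CommRing R] {a b c : R} (h1 : a + b + c = 0)
    (h2 : a * b + b * c + a * c = 3) (h3 : a * b * c = 2) :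
    ((a - b) * (b - c) * (a - c)) ^ 2 = -216 := by
  obtain rfl : c = -a - b := by linear_combination h1
  have h2' : a ^ 2 + a * b + b ^ 2 = -3 := by linear_combination -h2
  have h3' : a ^ 2 * b + a * b ^ 2 = -2 := by linear_combination -h3
  have : ((a - b) * (b - (-a - b)) * (a - (-a - b))) ^ 2 =
      4 * (a ^ 2 + a * b + b ^ 2) ^ 3 - 27 * (a ^ 2 * b + a * b ^ 2) ^ 2 := by ring
  rw [this, h2', h3']
  norm_num

theorem exists_sq_eq_neg_six : ∃ x : K6, x ^ 2 = -6 := by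
  obtain ⟨a, b, c, -, h1, h2, h3⟩ := exists_roots_cubic
  refine ⟨(a - b) * (b - c) * (a - c) / 6, ?_⟩
  rw [div_pow, sq_discr_cubic h1 h2 h3]
  norm_num

theorem two_dvd_finrank_K6 : 2 ∣ Module.finrank ℚ K6 := by
  obtain ⟨x, hx⟩ := exists_sq_eq_neg_six
  have hd : (X ^ 2 + 6 : ℚ[X]).natDegree = 2 := by compute_degree!
  have hm : (X ^ 2 + 6 : ℚ[X]).Monic := by monicity!
  have hi : Irreducible (X ^ 2 + 6 : ℚ[X]) := by
    rw [hm.irreducible_iff_roots_eq_zero_of_degree_le_three (by omega) (by omega)]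
    refine Multiset.eq_zero_of_forall_notMem fun y hy => ?_
    have h := (mem_roots'.1 hy).2
    simp only [IsRoot.def, eval_add, eval_pow, eval_X, eval_ofNat] at h
    nlinarith [sq_nonneg y]
  have hmin := minpoly.eq_of_irreducible_of_monic hi (x := x) (by rw [map_add, map_pow, aeval_X, map_ofNat, hx, neg_add_cancel]) hm
  rw [← hd, hmin]
  exact minpoly.degree_dvd (IsIntegral.of_finite ℚ x)

theorem nonempty_gal_K6_mulEquiv : Nonempty ((K6 ≃ₐ[ℚ] K6) ≃* Equiv.Perm (Fin 3)) := by
  have hroots : Fintype.card ((X ^ 3 + 3 * X - 2 : ℚ[X]).rootSet K6) = 3 :=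
    (card_rootSet_eq_natDegree irreducible_cubic.separable (SplittingField.splits _)).trans
      natDegree_X_pow_three_add_three_mul_X_sub_two
  have : Fact ((X ^ 3 + 3 * X - 2 : ℚ[X]).map (algebraMap ℚ K6)).Splits :=
    ⟨SplittingField.splits _⟩
  let φ := Gal.galActionHom (X ^ 3 + 3 * X - 2 : ℚ[X]) K6
  have hinj : Function.Injective φ := Gal.galActionHom_injective _ _
  have hperm : Nat.card (Equiv.Perm ((X ^ 3 + 3 * X - 2 : ℚ[X]).rootSet K6)) = 6 := by
    rw [Nat.card_perm, Nat.card_eq_fintype_card, hroots]; rfl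
  have h3 := Gal.prime_degree_dvd_card irreducible_cubic
    (by rw [natDegree_X_pow_three_add_three_mul_X_sub_two]; exact Nat.prime_three)
  have h2 : 2 ∣ Nat.card (X ^ 3 + 3 * X - 2 : ℚ[X]).Gal := by
    rw [Gal.card_of_separable irreducible_cubic.separable]
    exact two_dvd_finrank_K6
  rw [natDegree_X_pow_three_add_three_mul_X_sub_two] at h3
  have h6 : 6 ∣ Nat.card (X ^ 3 + 3 * X - 2 : ℚ[X]).Gal :=
    Nat.Coprime.mul_dvd_of_dvd_of_dvd (by norm_num : Nat.Coprime 2 3) h2 h3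
  have hbij : Function.Bijective φ :=
    hinj.bijective_of_nat_card_le (hperm.trans_le (Nat.le_of_dvd Nat.card_pos h6))
  exact ⟨(MulEquiv.ofBijective φ hbij).trans
    (Fintype.equivFinOfCardEq hroots).permCongrHom⟩

theorem neg_216_mem_differentIdeal_of_adjoin_eq_top {E L : Type*} [Field E] [NumberField E]
    [Field L] [NumberField L] [Algebra E L] {a : 𝓞 E} {b c : 𝓞 L}
    (ha : Algebra.adjoin ℚ {(a : E)} = ⊤) (hb : Algebra.adjoin E {(b : L)} = ⊤)
    (h1 : algebraMap (𝓞 E) (𝓞 L) a + b + c = 0)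
    (h2 : algebraMap (𝓞 E) (𝓞 L) a * b + b * c + algebraMap (𝓞 E) (𝓞 L) a * c = 3)
    (h3 : algebraMap (𝓞 E) (𝓞 L) a * b * c = 2) :
    ((-216 : ℤ) : 𝓞 L) ∈ differentIdeal ℤ (𝓞 L) := by
  have hda : 3 * a ^ 2 + 3 ∈ differentIdeal ℤ (𝓞 E) := by
    have hg : aeval a (X ^ 3 + 3 * X - 2 : ℤ[X]) = 0 := by
      apply FaithfulSMul.algebraMap_injective (𝓞 E) (𝓞 L)
      simp only [map_sub, map_add, map_mul, map_pow, aeval_X, map_ofNat, map_zero]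
      linear_combination algebraMap (𝓞 E) (𝓞 L) a ^ 2 * h1 - algebraMap (𝓞 E) (𝓞 L) a * h2 + h3
    have h := aeval_derivative_mem_differentIdeal_of_aeval_eq_zero ℤ ℚ E ha hg
    simpa [map_ofNat (aeval a)] using h
  generalize hA : algebraMap (𝓞 E) (𝓞 L) a = A at *
  have hdb : 2 * b + A ∈ differentIdeal (𝓞 E) (𝓞 L) := by
    have hg : aeval b (X ^ 2 + C a * X + C (a ^ 2 + 3) : (𝓞 E)[X]) = 0 := by
      simp only [map_add, map_mul, map_pow, aeval_X, aeval_C, map_ofNat, hA]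
      linear_combination (A + b) * h1 - h2
    have h := aeval_derivative_mem_differentIdeal_of_aeval_eq_zero (𝓞 E) E L hb hg
    rw [derivative_add, derivative_C] at h
    simpa [hA, one_add_one_eq_two, map_ofNat (algebraMap (𝓞 E) (𝓞 L))] using h
  have hmem : (2 * b + A) * (3 * A ^ 2 + 3) ∈ differentIdeal ℤ (𝓞 L) := by
    rw [differentIdeal_eq_differentIdeal_mul_differentIdeal ℤ (𝓞 E) (𝓞 L)]
    refine Ideal.mul_mem_mul hdb ?_
    have h := Ideal.mem_map_of_mem (algebraMap (𝓞 E) (𝓞 L)) hda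
    simpa only [map_add, map_mul, map_pow, map_ofNat, hA] using h
  have hdisc : (A - b) * (b - c) * (A - c) = (2 * b + A) * (3 * A ^ 2 + 3) := by
    obtain rfl : c = -A - b := by linear_combination h1
    linear_combination (2 * b + A) * h2
  have hsq := sq_discr_cubic h1 h2 h3
  rw [hdisc] at hsq
  rw [show ((-216 : ℤ) : 𝓞 L) = -216 by norm_num, ← hsq, sq]
  exact Ideal.mul_mem_right _ _ hmem

theorem neg_216_mem_differentIdeal_K6 : ((-216 : ℤ) : 𝓞 K6) ∈ differentIdeal ℤ (𝓞 K6) := by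
  obtain ⟨a, b, c, hroots, h1, h2, h3⟩ := exists_roots_cubic
  have hm : (X ^ 3 + 3 * X - 2 : ℤ[X]).Monic := by monicity!
  have hint {t : K6} (ht : t ^ 3 + 3 * t - 2 = 0) : IsIntegral ℤ t := by
    refine ⟨_, hm, ?_⟩
    rw [← aeval_def]
    simpa only [map_sub, map_add, map_mul, map_pow, aeval_X, map_ofNat] using ht
  have ha : IsIntegral ℤ a := hint (by linear_combination a ^ 2 * h1 - a * h2 + h3)
  have hb : IsIntegral ℤ b := hint (by linear_combination b ^ 2 * h1 - b * h2 + h3)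
  have hc : IsIntegral ℤ c := hint (by linear_combination c ^ 2 * h1 - c * h2 + h3)
  let E := IntermediateField.adjoin ℚ {a}
  let a' : E := IntermediateField.AdjoinSimple.gen ℚ a
  have haE : algebraMap E K6 a' = a := IntermediateField.AdjoinSimple.algebraMap_gen ℚ a
  have ha' : IsIntegral ℤ a' :=
    (isIntegral_algebraMap_iff (algebraMap E K6).injective).1 (haE.symm ▸ ha)
  have htopE : Algebra.adjoin ℚ {a'} = ⊤ := by
    have h := (IntermediateField.adjoin.powerBasis (IsIntegral.of_finite ℚ a)).adjoin_gen_eq_top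
    rwa [IntermediateField.adjoin.powerBasis_gen] at h
  have htopK : Algebra.adjoin E {b} = ⊤ := by
    have hle : Algebra.adjoin ℚ ((X ^ 3 + 3 * X - 2 : ℚ[X]).rootSet K6) ≤
        (Algebra.adjoin E {b}).restrictScalars ℚ := by
      rw [Algebra.adjoin_le_iff, hroots]
      have ham : a ∈ Algebra.adjoin E {b} := haE ▸ Subalgebra.algebraMap_mem _ a'
      have hbm : b ∈ Algebra.adjoin E {b} := Algebra.self_mem_adjoin_singleton E b
      have hcm : c ∈ Algebra.adjoin E {b} := by
        have : c = -a - b := by linear_combination h1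
        exact this ▸ sub_mem (neg_mem ham) hbm
      rintro x (rfl | rfl | rfl) <;> assumption
    refine eq_top_iff.2 fun x _ => hle ?_
    exact (SplittingField.adjoin_rootSet (X ^ 3 + 3 * X - 2 : ℚ[X])).ge Algebra.mem_top
  let A : 𝓞 E := ⟨a', ha'⟩
  let B : 𝓞 K6 := ⟨b, hb⟩
  let C : 𝓞 K6 := ⟨c, hc⟩
  exact neg_216_mem_differentIdeal_of_adjoin_eq_top (a := A) (b := B) (c := C) htopE htopK
    (RingOfIntegers.ext h1) (RingOfIntegers.ext h2) (RingOfIntegers.ext h3)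

/-- The splitting field K₆ of X³ + 3X − 2 over ℚ has Galois group S₃, contains √-6,
and is ramified only at primes in {2,3}. -/
theorem stmt_9 :
    Nonempty ((K6 ≃ₐ[ℚ] K6) ≃* Equiv.Perm (Fin 3)) ∧
    (∃ x : K6, x ^ 2 = -6) ∧
    (∀ p : ℕ, p.Prime → (p : ℤ) ∣ NumberField.discr K6 → p = 2 ∨ p = 3) := by
  refine ⟨nonempty_gal_K6_mulEquiv, exists_sq_eq_neg_six, fun p hp hpd => ?_⟩
  have h := prime_dvd_of_dvd_discr_of_mem_differentIdeal neg_216_mem_differentIdeal_K6 hp hpd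
  have h' : p ∣ 2 ^ 3 * 3 ^ 3 := Int.natCast_dvd.1 h
  rcases hp.dvd_mul.1 h' with h' | h'
  · exact .inl ((Nat.prime_dvd_prime_iff_eq hp Nat.prime_two).1 (hp.dvd_of_dvd_pow h'))
  · exact .inr ((Nat.prime_dvd_prime_iff_eq hp Nat.prime_three).1 (hp.dvd_of_dvd_pow h'))
end

section
/- The group Γ¹(5) = {[[a,b],[c,d]] ∈ SL₂(ℤ) : b ≡ 0 (mod 5), a ≡ d ≡ 1 (mod 5)} is generated, as a subgroup of SL₂(ℤ), by the three matrices γ = [[1,5],[0,1]], δ = [[1,0],[-1,1]], and AδA⁻¹ = [[11,25],[-4,-9]], where A = [[-2,-5],[1,2]]. -/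
open Matrix MatrixGroups Matrix.SpecialLinearGroup

/-- The matrix γ = [[1,5],[0,1]] in SL(2,ℤ). -/
def γ : SL(2, ℤ) := ⟨!![1, 5; 0, 1], by norm_num [Matrix.det_fin_two_of]⟩

/-- The matrix δ = [[1,0],[-1,1]] in SL(2,ℤ). -/
def δ : SL(2, ℤ) := ⟨!![1, 0; -1, 1], by norm_num [Matrix.det_fin_two_of]⟩

/-- The matrix A = [[-2,-5],[1,2]] in SL(2,ℤ). -/
def A : SL(2, ℤ) := ⟨!![-2, -5; 1, 2], by norm_num [Matrix.det_fin_two_of]⟩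

/-- Γ⁰(5): matrices in SL(2,ℤ) whose upper right-hand entry is divisible by 5. -/
def Gamma0' : Subgroup SL(2, ℤ) where
  carrier := { g : SL(2, ℤ) | (g.1 0 1 : ZMod 5) = 0 }
  one_mem' := by simp
  mul_mem' := by
    intro a b ha hb
    simp only [Set.mem_setOf_eq] at *
    have h := (Matrix.two_mul_expl a.1 b.1).2.1
    simp only [coe_mul] at *
    rw [h]
    push_cast
    rw [ha, hb]
    ring
  inv_mem' := by
    intro a ha
    simp only [Set.mem_setOf_eq] at *
    rw [SL2_inv_expl a]
    simp only [Matrix.cons_val', Matrix.cons_val_zero, Matrix.cons_val_one, Matrix.head_cons]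
    push_cast
    rw [ha]
    ring

/-- Γ¹(5): matrices [[a,b],[c,d]] in SL(2,ℤ) with b ≡ 0 and a ≡ d ≡ 1 (mod 5). -/
def Gamma1' : Subgroup SL(2, ℤ) where
  carrier := { g : SL(2, ℤ) | (g.1 0 1 : ZMod 5) = 0 ∧ (g.1 0 0 : ZMod 5) = 1 ∧
    (g.1 1 1 : ZMod 5) = 1 }
  one_mem' := by simp
  mul_mem' := by
    intro a b ha hb
    obtain ⟨ha1, ha2, ha3⟩ := ha
    obtain ⟨hb1, hb2, hb3⟩ := hb
    have h00 := (Matrix.two_mul_expl a.1 b.1).1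
    have h01 := (Matrix.two_mul_expl a.1 b.1).2.1
    have h11 := (Matrix.two_mul_expl a.1 b.1).2.2.2
    refine ⟨?_, ?_, ?_⟩
    · simp only [Set.mem_setOf_eq, coe_mul]; rw [h01]; push_cast
      rw [ha1, ha2, hb1]; ring
    · simp only [Set.mem_setOf_eq, coe_mul]; rw [h00]; push_cast
      rw [ha1, ha2, hb2]; ring
    · simp only [Set.mem_setOf_eq, coe_mul]; rw [h11]; push_cast
      rw [ha3, hb1, hb3]; ring
  inv_mem' := by
    intro a ha
    obtain ⟨ha1, ha2, ha3⟩ := ha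
    rw [Set.mem_setOf_eq, SL2_inv_expl a]
    simp only [Matrix.cons_val', Matrix.cons_val_zero, Matrix.cons_val_one, Matrix.head_cons]
    push_cast
    exact ⟨by rw [ha1]; ring, by rw [ha3], by rw [ha2]⟩

/-- The noncongruence subgroup Γ of the paper, generated by the eight listed elements. -/
def Γpaper : Subgroup SL(2, ℤ) :=
  Subgroup.closure {γ ^ 3, δ, A * γ ^ 3 * A⁻¹, A * δ * A⁻¹, γ * δ * γ⁻¹,
    γ * (A * δ * A⁻¹) * γ⁻¹, γ ^ 2 * δ * (γ ^ 2)⁻¹, γ ^ 2 * (A * δ * A⁻¹) * (γ ^ 2)⁻¹}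

theorem Gamma1'_mem_iff (g : SL(2, ℤ)) :
    g ∈ Gamma1' ↔ g.1 0 1 % 5 = 0 ∧ g.1 0 0 % 5 = 1 ∧ g.1 1 1 % 5 = 1 := by
  have h (x y : ℤ) : (x : ZMod 5) = (y : ZMod 5) ↔ x % 5 = y % 5 :=
    ZMod.intCast_eq_intCast_iff x y 5
  have h0 := h (g.1 0 1) 0
  have h1 := h (g.1 0 0) 1
  have h2 := h (g.1 1 1) 1
  push_cast at h0 h1 h2
  exact and_congr h0 (and_congr h1 h2)

theorem coe_A_mul_δ_mul_A_inv : (A * δ * A⁻¹).1 = !![11, 25; -4, -9] := by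
  rw [coe_mul, coe_mul, coe_inv]
  simp [A, δ, adjugate_fin_two_of]

theorem coe_γ_zpow (k : ℤ) : (γ ^ k).1 = !![1, 5 * k; 0, 1] := by
  have h : γ = ModularGroup.T ^ (5 : ℤ) := by
    apply Subtype.ext
    rw [ModularGroup.coe_T_zpow]
    rfl
  rw [h, ← _root_.zpow_mul, ModularGroup.coe_T_zpow]

theorem coe_δ_zpow (k : ℤ) : (δ ^ k).1 = !![1, 0; -k, 1] := by
  have h : δ = ModularGroup.S * ModularGroup.T * ModularGroup.S⁻¹ := by
    apply Subtype.ext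
    rw [coe_mul, coe_mul, coe_inv]
    simp [ModularGroup.S, ModularGroup.T, δ, adjugate_fin_two_of]
  rw [h, conj_zpow, coe_mul, coe_mul, ModularGroup.coe_T_zpow, coe_inv]
  simp [ModularGroup.S, adjugate_fin_two_of]

theorem mul_coe_apply_zero_zero (g h : SL(2, ℤ)) :
    (g * h).1 0 0 = g.1 0 0 * h.1 0 0 + g.1 0 1 * h.1 1 0 := by
  rw [coe_mul, Matrix.mul_apply, Fin.sum_univ_two]

theorem mul_coe_apply_zero_one (g h : SL(2, ℤ)) :
    (g * h).1 0 1 = g.1 0 0 * h.1 0 1 + g.1 0 1 * h.1 1 1 := by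
  rw [coe_mul, Matrix.mul_apply, Fin.sum_univ_two]

theorem closure_le_Gamma1' : Subgroup.closure {γ, δ, A * δ * A⁻¹} ≤ Gamma1' := by
  rw [Subgroup.closure_le]
  rintro g (rfl | rfl | rfl) <;> rw [SetLike.mem_coe, Gamma1'_mem_iff]
  · simp [γ]
  · simp [δ]
  · rw [coe_A_mul_δ_mul_A_inv]
    simp

/-- Any integer `b` can be translated by a multiple of `5 * a` so that the quotient by `a` lies in
`[0, 5)`. -/
theorem exists_add_five_mul_mem (a b : ℤ) (ha : a ≠ 0) :
    ∃ q : ℤ, (0 < a ∧ 0 ≤ a * (5 * q) + b ∧ a * (5 * q) + b < 5 * a) ∨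
      (a < 0 ∧ a * (5 * q) + b ≤ 0 ∧ 5 * a < a * (5 * q) + b) := by
  rcases lt_or_gt_of_ne ha with h | h
  · refine ⟨-(-b / (5 * -a)), Or.inr ⟨h, ?_⟩⟩
    have h1 := Int.emod_nonneg (-b) (show 5 * -a ≠ 0 by omega)
    have h2 := Int.emod_lt_of_pos (-b) (show 0 < 5 * -a by omega)
    rw [Int.emod_def] at h1 h2
    constructor <;> linarith
  · refine ⟨-(b / (5 * a)), Or.inl ⟨h, ?_⟩⟩
    have h1 := Int.emod_nonneg b (show 5 * a ≠ 0 by omega)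
    have h2 := Int.emod_lt_of_pos b (show 0 < 5 * a by omega)
    rw [Int.emod_def] at h1 h2
    constructor <;> linarith

theorem mem_closure_of_apply_zero_one_eq_zero (g : SL(2, ℤ)) (hg : g ∈ Gamma1')
    (hb : g.1 0 1 = 0) : g ∈ Subgroup.closure {γ, δ, A * δ * A⁻¹} := by
  obtain ⟨-, ha, hd⟩ := (Gamma1'_mem_iff g).1 hg
  have hdet := g.2
  rw [Matrix.det_fin_two, hb, zero_mul, sub_zero] at hdet
  have ha1 : g.1 0 0 = 1 := by
    rcases Int.isUnit_iff.1 (IsUnit.of_mul_eq_one _ hdet) with h | h <;> omega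
  have hd1 : g.1 1 1 = 1 := by rwa [ha1, one_mul] at hdet
  have h : g = δ ^ (-g.1 1 0) := by
    apply Subtype.ext
    rw [coe_δ_zpow, neg_neg, Matrix.eta_fin_two g.1, ha1, hb, hd1]
    simp
  rw [h]
  exact zpow_mem (Subgroup.subset_closure (by simp)) _

/-- The vector `(2, 5)` is not proportional to the top row of an element of `Γ¹(5)`. -/
theorem two_mul_apply_zero_one_ne (g : SL(2, ℤ)) (hg : g ∈ Gamma1') :
    2 * g.1 0 1 ≠ 5 * g.1 0 0 := by
  intro h
  obtain ⟨hb, ha, -⟩ := (Gamma1'_mem_iff g).1 hg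
  have hdet := g.2
  rw [Matrix.det_fin_two] at hdet
  obtain ⟨k, hk⟩ : ∃ k, g.1 0 0 = 2 * k := ⟨g.1 0 0 / 2, by omega⟩
  have hk' : g.1 0 1 = 5 * k := by omega
  rw [hk, hk'] at hdet
  have hu : k * (2 * g.1 1 1 - 5 * g.1 1 0) = 1 := by linarith
  rcases Int.isUnit_iff.1 (IsUnit.of_mul_eq_one _ hu) with h | h <;> omega

/-- If the ratio of the top row entries of `g` lies in `(0, 5)`, then right multiplication by an
element of the subgroup generated by `γ`, `δ` and `AδA⁻¹` makes the upper left entry smaller. -/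
theorem exists_mem_closure_natAbs_lt (g : SL(2, ℤ)) (hg : g ∈ Gamma1')
    (h : (0 < g.1 0 0 ∧ 0 < g.1 0 1 ∧ g.1 0 1 < 5 * g.1 0 0) ∨
      (g.1 0 0 < 0 ∧ g.1 0 1 < 0 ∧ 5 * g.1 0 0 < g.1 0 1)) :
    ∃ x ∈ Subgroup.closure {γ, δ, A * δ * A⁻¹}, ((g * x).1 0 0).natAbs < (g.1 0 0).natAbs := by
  have hγ : γ ∈ Subgroup.closure {γ, δ, A * δ * A⁻¹} := Subgroup.subset_closure (by simp)
  have hδ : δ ∈ Subgroup.closure {γ, δ, A * δ * A⁻¹} := Subgroup.subset_closure (by simp)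
  have hA : A * δ * A⁻¹ ∈ Subgroup.closure {γ, δ, A * δ * A⁻¹} :=
    Subgroup.subset_closure (by simp)
  obtain ⟨hb, ha, -⟩ := (Gamma1'_mem_iff g).1 hg
  have hne := two_mul_apply_zero_one_ne g hg
  have h1 : (g * δ).1 0 0 = g.1 0 0 - g.1 0 1 := by
    rw [mul_coe_apply_zero_zero]
    simp only [δ, of_apply, cons_val]
    ring
  have h2 : (g * (A * δ * A⁻¹)).1 0 0 = 11 * g.1 0 0 - 4 * g.1 0 1 := by
    rw [mul_coe_apply_zero_zero, coe_A_mul_δ_mul_A_inv]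
    simp only [of_apply, cons_val]
    ring
  have h2' : (g * (A * δ * A⁻¹)⁻¹).1 0 0 = -9 * g.1 0 0 + 4 * g.1 0 1 := by
    rw [mul_coe_apply_zero_zero, SL2_inv_expl]
    simp only [coe_A_mul_δ_mul_A_inv, of_apply, cons_val]
    ring
  have h3 : (g * (γ ^ (-1 : ℤ) * δ⁻¹)).1 0 0 = -4 * g.1 0 0 + g.1 0 1 := by
    rw [← mul_assoc, mul_coe_apply_zero_zero, mul_coe_apply_zero_zero, mul_coe_apply_zero_one,
      SL2_inv_expl, coe_γ_zpow]
    simp only [δ, of_apply, cons_val]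
    ring
  by_cases c1 : ((g * δ).1 0 0).natAbs < (g.1 0 0).natAbs
  · exact ⟨_, hδ, c1⟩
  by_cases c2 : ((g * (A * δ * A⁻¹)).1 0 0).natAbs < (g.1 0 0).natAbs
  · exact ⟨_, hA, c2⟩
  by_cases c3 : ((g * (A * δ * A⁻¹)⁻¹).1 0 0).natAbs < (g.1 0 0).natAbs
  · exact ⟨_, inv_mem hA, c3⟩
  refine ⟨_, mul_mem (zpow_mem hγ (-1)) (inv_mem hδ), ?_⟩
  rw [h3]
  rw [h1] at c1
  rw [h2] at c2
  rw [h2'] at c3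
  omega

theorem Gamma1'_le_closure : Gamma1' ≤ Subgroup.closure {γ, δ, A * δ * A⁻¹} := by
  intro g hg
  induction hn : (g.1 0 0).natAbs using Nat.strong_induction_on generalizing g with
  | _ n ih =>
  obtain ⟨-, ha, -⟩ := (Gamma1'_mem_iff g).1 hg
  obtain ⟨q, hq⟩ := exists_add_five_mul_mem (g.1 0 0) (g.1 0 1) (by omega)
  have hγ : γ ^ q ∈ Subgroup.closure {γ, δ, A * δ * A⁻¹} :=
    zpow_mem (Subgroup.subset_closure (by simp)) q
  have hg' : g * γ ^ q ∈ Gamma1' := mul_mem hg (closure_le_Gamma1' hγ)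
  have h0 : (g * γ ^ q).1 0 0 = g.1 0 0 := by
    simp [mul_coe_apply_zero_zero, coe_γ_zpow]
  have h1 : (g * γ ^ q).1 0 1 = g.1 0 0 * (5 * q) + g.1 0 1 := by
    simp [mul_coe_apply_zero_one, coe_γ_zpow]
  rw [← h1, ← h0] at hq
  rw [← Subgroup.mul_mem_cancel_right _ hγ]
  by_cases hb : (g * γ ^ q).1 0 1 = 0
  · exact mem_closure_of_apply_zero_one_eq_zero _ hg' hb
  obtain ⟨x, hx, hlt⟩ := exists_mem_closure_natAbs_lt _ hg' (by omega)
  rw [← Subgroup.mul_mem_cancel_right _ hx]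
  exact ih _ (by rwa [h0, hn] at hlt) (mul_mem hg' (closure_le_Gamma1' hx)) rfl

/-- Γ¹(5) is generated by γ, δ and AδA⁻¹. -/
theorem stmt_13 : Subgroup.closure {γ, δ, A * δ * A⁻¹} = Gamma1' := by
  exact le_antisymm closure_le_Gamma1' Gamma1'_le_closure
end

section
/- The group Γ is a noncongruence subgroup of SL₂(ℤ): Γ has finite index in SL₂(ℤ), but for no positive integer N does Γ contain the principal congruence subgroup Γ(N) = ker(SL₂(ℤ) → SL₂(ℤ/Nℤ)). -/
open Matrix MatrixGroups Matrix.SpecialLinearGroup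

/-- A Schreier-type criterion: if the finitely many cosets `H * r i` are permuted under right
multiplication by each element of `s`, then `H` has finite relative index in `closure s`. -/
theorem Subgroup.relIndex_closure_ne_zero {G ι : Type*} [Group G] [Finite ι] (H : Subgroup G)
    (s : Set G) (r : ι → G) (i₀ : ι) (h_one : r i₀ = 1)
    (hs : ∀ g ∈ s, ∃ σ : ι → ι, Function.Surjective σ ∧ ∀ i, r i * g * (r (σ i))⁻¹ ∈ H) :
    H.relIndex (Subgroup.closure s) ≠ 0 := by
  have cover : ∀ x ∈ Subgroup.closure s, ∃ i, x * (r i)⁻¹ ∈ H := by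
    intro x hx
    induction hx using Subgroup.closure_induction_right with
    | one => exact ⟨i₀, by simp [h_one]⟩
    | mul_right x hx g hg ih =>
      obtain ⟨i, hi⟩ := ih
      obtain ⟨σ, -, hσ⟩ := hs g hg
      exact ⟨σ i, by simpa [mul_assoc] using H.mul_mem hi (hσ i)⟩
    | mul_inv_cancel x hx g hg ih =>
      obtain ⟨i, hi⟩ := ih
      obtain ⟨σ, hsurj, hσ⟩ := hs g hg
      obtain ⟨j, rfl⟩ := hsurj i
      exact ⟨j, by simpa [mul_assoc] using H.mul_mem hi (H.inv_mem (hσ j))⟩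
  let L := Subgroup.closure s
  choose c hc using fun x : L => cover (x⁻¹ : L) (x⁻¹ : L).2
  have : Finite (L ⧸ H.subgroupOf L) := by
    refine Finite.of_injective (fun q => c q.out) fun p q hpq => ?_
    rw [← p.out_eq', ← q.out_eq', QuotientGroup.eq, Subgroup.mem_subgroupOf]
    have hp := hc p.out
    have hq := hc q.out
    simp only at hpq
    rw [← hpq] at hq
    simpa using H.mul_mem hp (H.inv_mem hq)
  exact Subgroup.index_ne_zero_of_finite

theorem A_sq : A ^ 2 = -1 := by decide

theorem mem_Γpaper_conj_δ (i : Fin 3) : γ ^ (i : ℕ) * δ * (γ ^ (i : ℕ))⁻¹ ∈ Γpaper := by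
  apply Subgroup.subset_closure
  fin_cases i <;> simp

theorem mem_Γpaper_conj_AδA (i : Fin 3) :
    γ ^ (i : ℕ) * (A * δ * A⁻¹) * (γ ^ (i : ℕ))⁻¹ ∈ Γpaper := by
  apply Subgroup.subset_closure
  fin_cases i <;> simp

theorem relIndex_Γpaper_ne_zero :
    Γpaper.relIndex (Subgroup.closure {γ, δ, A * δ * A⁻¹}) ≠ 0 := by
  refine Subgroup.relIndex_closure_ne_zero _ _ (fun i : Fin 3 => γ ^ (i : ℕ)) 0 (by simp) ?_
  rintro g (rfl | rfl | rfl)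
  · refine ⟨![1, 2, 0], by decide, fun i => ?_⟩
    have h : γ ^ 3 ∈ Γpaper := Subgroup.subset_closure (by simp)
    fin_cases i
    · simp
    · simp [pow_two]
    · simpa [← pow_succ] using h
  · exact ⟨id, Function.surjective_id, mem_Γpaper_conj_δ⟩
  · exact ⟨id, Function.surjective_id, mem_Γpaper_conj_AδA⟩

theorem relIndex_closure_γδ_ne_zero :
    (Subgroup.closure {γ, δ, A * δ * A⁻¹}).relIndex (Subgroup.closure {A, γ, δ}) ≠ 0 := by
  have hγ : γ ∈ Subgroup.closure {γ, δ, A * δ * A⁻¹} := Subgroup.subset_closure (by simp)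
  have hδ : δ ∈ Subgroup.closure {γ, δ, A * δ * A⁻¹} := Subgroup.subset_closure (by simp)
  have hε : A * δ * A⁻¹ ∈ Subgroup.closure {γ, δ, A * δ * A⁻¹} :=
    Subgroup.subset_closure (by simp)
  have hAγ : A * γ * A⁻¹ ∈ Subgroup.closure {γ, δ, A * δ * A⁻¹} := by
    rw [show A * γ * A⁻¹ = (A * δ * A⁻¹)⁻¹ * (δ * γ)⁻¹ by decide]
    exact mul_mem (inv_mem hε) (inv_mem (mul_mem hδ hγ))
  refine Subgroup.relIndex_closure_ne_zero _ _ (fun i : Fin 4 => A ^ (i : ℕ)) 0 (by simp) ?_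
  rintro g (rfl | rfl | rfl)
  · refine ⟨![1, 2, 3, 0], by decide, fun i => ?_⟩
    have h : ∀ i : Fin 4,
        A ^ (i : ℕ) * A * (A ^ ((![1, 2, 3, 0] : Fin 4 → Fin 4) i : ℕ))⁻¹ = 1 := by decide
    exact h i ▸ one_mem _
  · refine ⟨id, Function.surjective_id, fun i => ?_⟩
    fin_cases i
    · simpa using hγ
    · simpa using hAγ
    · simpa [A_sq] using hγ
    · simpa [pow_succ A 2, A_sq] using hAγ
  · refine ⟨id, Function.surjective_id, fun i => ?_⟩
    fin_cases i
    · simpa using hδ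
    · simpa using hε
    · simpa [A_sq] using hδ
    · simpa [pow_succ A 2, A_sq] using hε

theorem relIndex_closure_Aγδ_ne_zero :
    (Subgroup.closure {A, γ, δ}).relIndex ⊤ ≠ 0 := by
  have hA : A ∈ Subgroup.closure {A, γ, δ} := Subgroup.subset_closure (by simp)
  have hγ : γ ∈ Subgroup.closure {A, γ, δ} := Subgroup.subset_closure (by simp)
  have hδ : δ ∈ Subgroup.closure {A, γ, δ} := Subgroup.subset_closure (by simp)
  rw [← SpecialLinearGroup.SL2Z_generators]
  let r : Fin 6 → SL(2, ℤ) :=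
    ![1, ModularGroup.T, ModularGroup.T ^ 2, ModularGroup.T ^ 3, ModularGroup.T ^ 4,
      ModularGroup.S]
  refine Subgroup.relIndex_closure_ne_zero _ _ r 0 rfl ?_
  rintro g (rfl | rfl)
  · refine ⟨![5, 4, 2, 3, 1, 0], by decide, fun i => ?_⟩
    have h : ∀ i, r i * ModularGroup.S * (r (![5, 4, 2, 3, 1, 0] i))⁻¹ =
      ![1, δ⁻¹ * γ⁻¹, A ^ 2 * γ * A * δ, γ * A * γ⁻¹, A ^ 2 * γ * δ, A ^ 2] i := by decide
    rw [h]
    fin_cases i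
    · exact one_mem _
    · exact mul_mem (inv_mem hδ) (inv_mem hγ)
    · exact mul_mem (mul_mem (mul_mem (pow_mem hA 2) hγ) hA) hδ
    · exact mul_mem (mul_mem hγ hA) (inv_mem hγ)
    · exact mul_mem (mul_mem (pow_mem hA 2) hγ) hδ
    · exact pow_mem hA 2
  · refine ⟨![1, 2, 3, 4, 0, 5], by decide, fun i => ?_⟩
    have h : ∀ i, r i * ModularGroup.T * (r (![1, 2, 3, 4, 0, 5] i))⁻¹ =
      ![1, 1, 1, 1, γ, δ] i := by decide
    rw [h]
    fin_cases i
    exacts [one_mem _, one_mem _, one_mem _, one_mem _, hγ, hδ]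

theorem finiteIndex_Γpaper : Γpaper.FiniteIndex := by
  rw [← Subgroup.isFiniteRelIndex_top_iff, Subgroup.isFiniteRelIndex_iff_relIndex_ne_zero]
  exact Subgroup.relIndex_ne_zero_trans
    (Subgroup.relIndex_ne_zero_trans relIndex_Γpaper_ne_zero relIndex_closure_γδ_ne_zero)
    relIndex_closure_Aγδ_ne_zero

/-- Free generators of `Γ¹(5)`, adapted to the ideal hexagon with vertices
`∞, -3, -5/2, -2, -1, 0`. -/
def freeGen : Fin 3 → SL(2, ℤ) := ![δ, A * δ * A⁻¹, δ * γ]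

/-- The matrices sending `∞` into the arc `[-1, 0)`, `[-3, -5/2)`, `[-2, -1)` respectively. -/
def arcAttr : Fin 3 → Set SL(2, ℤ) := ![
  {m | (0 < m 1 0 ∧ -m 1 0 ≤ m 0 0 ∧ m 0 0 < 0) ∨ (m 1 0 < 0 ∧ m 0 0 ≤ -m 1 0 ∧ 0 < m 0 0)},
  {m | (0 < m 1 0 ∧ -3 * m 1 0 ≤ m 0 0 ∧ 2 * m 0 0 < -5 * m 1 0) ∨
    (m 1 0 < 0 ∧ m 0 0 ≤ -3 * m 1 0 ∧ -5 * m 1 0 < 2 * m 0 0)},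
  {m | (0 < m 1 0 ∧ -2 * m 1 0 ≤ m 0 0 ∧ m 0 0 < -m 1 0) ∨
    (m 1 0 < 0 ∧ m 0 0 ≤ -2 * m 1 0 ∧ -m 1 0 < m 0 0)}]

/-- The matrices sending `∞` into the arc `[0, ∞)`, `[-5/2, -2)`, `[∞, -3)` respectively. -/
def arcRep : Fin 3 → Set SL(2, ℤ) := ![
  {m | (0 < m 1 0 ∧ 0 ≤ m 0 0) ∨ (m 1 0 < 0 ∧ m 0 0 ≤ 0)},
  {m | (0 < m 1 0 ∧ -5 * m 1 0 ≤ 2 * m 0 0 ∧ m 0 0 < -2 * m 1 0) ∨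
    (m 1 0 < 0 ∧ 2 * m 0 0 ≤ -5 * m 1 0 ∧ -2 * m 1 0 < m 0 0)},
  {m | (0 < m 1 0 ∧ m 0 0 < -3 * m 1 0) ∨ (m 1 0 < 0 ∧ -3 * m 1 0 < m 0 0) ∨ m 1 0 = 0}]

theorem col_zero_ne_zero (m : SL(2, ℤ)) : m 0 0 ≠ 0 ∨ m 1 0 ≠ 0 := by
  by_contra! h
  have := m.det_coe
  rw [Matrix.det_fin_two, h.1, h.2] at this
  simp at this

theorem freeGen_injective : Function.Injective (FreeGroup.lift freeGen) := by
  have hgen : ∀ i, (freeGen i).1 =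
      ![!![1, 0; -1, 1], !![11, 25; -4, -9], !![1, 5; -1, -4]] i := by decide
  have hinv : ∀ i, ((freeGen i)⁻¹).1 =
      ![!![1, 0; 1, 1], !![-9, -25; 4, 11], !![-4, -5; 1, 1]] i := by decide
  refine FreeGroup.injective_lift_of_ping_pong freeGen arcAttr arcRep ?_ ?_ ?_ ?_ ?_ ?_
  · intro i
    fin_cases i
    · exact ⟨⟨!![-1, 0; 2, -1], by decide⟩, Or.inl (by decide)⟩
    · exact ⟨⟨!![-3, -1; 1, 0], by decide⟩, Or.inl (by decide)⟩
    · exact ⟨⟨!![-2, -1; 1, 0], by decide⟩, Or.inl (by decide)⟩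
  · intro i j hij
    simp only [Function.onFun, Set.disjoint_left]
    intro m
    fin_cases i <;> fin_cases j <;> simp [arcAttr] at hij ⊢ <;> lia
  · intro i j hij
    simp only [Function.onFun, Set.disjoint_left]
    intro m
    fin_cases i <;> fin_cases j <;> simp [arcRep] at hij ⊢ <;> lia
  · intro i j
    simp only [Set.disjoint_left]
    intro m
    fin_cases i <;> fin_cases j <;> simp [arcAttr, arcRep] <;> lia
  · rintro i _ ⟨m, hm, rfl⟩
    have := col_zero_ne_zero m
    have hcol : ∀ k, (freeGen i * m) k 0 = (freeGen i).1 k 0 * m 0 0 + (freeGen i).1 k 1 * m 1 0 :=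
      fun k => by simp [Matrix.mul_apply, Fin.sum_univ_two]
    change freeGen i * m ∈ arcAttr i
    rw [hgen] at hcol
    fin_cases i <;> simp [arcAttr, arcRep, -coe_mul] at hm hcol ⊢ <;> lia
  · rintro i _ ⟨m, hm, rfl⟩
    have := col_zero_ne_zero m
    have hcol : ∀ k, ((freeGen i)⁻¹ * m) k 0 =
        ((freeGen i)⁻¹).1 k 0 * m 0 0 + ((freeGen i)⁻¹).1 k 1 * m 1 0 :=
      fun k => by simp only [coe_mul, Matrix.mul_apply, Fin.sum_univ_two]
    change (freeGen i)⁻¹ * m ∈ arcRep i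
    rw [hinv] at hcol
    fin_cases i <;> simp [arcAttr, arcRep, -coe_mul, -coe_inv] at hm hcol ⊢ <;> lia

/-- The character of the free group whose kernel corresponds to `Γpaper`. -/
def charThree : FreeGroup (Fin 3) →* Multiplicative (ZMod 3) :=
  FreeGroup.lift ![1, 1, Multiplicative.ofAdd 1]

theorem Γpaper_le_map_ker_charThree : Γpaper ≤ charThree.ker.map (FreeGroup.lift freeGen) := by
  let d : FreeGroup (Fin 3) := .of 0
  let e : FreeGroup (Fin 3) := .of 1
  let h : FreeGroup (Fin 3) := .of 2
  have hg : FreeGroup.lift freeGen (d⁻¹ * h) = γ := by simp [d, h, freeGen]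
  have hd : FreeGroup.lift freeGen d = δ := by simp [d, freeGen]
  have he : FreeGroup.lift freeGen e = A * δ * A⁻¹ := by simp [e, freeGen]
  have hf : FreeGroup.lift freeGen (e⁻¹ * h⁻¹) = A * γ * A⁻¹ := by
    rw [show A * γ * A⁻¹ = (A * δ * A⁻¹)⁻¹ * (δ * γ)⁻¹ by decide]
    simp [e, h, freeGen]
  have cd : charThree d = 1 := by simp [d, charThree]
  have ce : charThree e = 1 := by simp [e, charThree]
  have ch : charThree h = Multiplicative.ofAdd 1 := by simp [h, charThree]
  have three : (Multiplicative.ofAdd 1 : Multiplicative (ZMod 3)) ^ 3 = 1 := by decide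
  rw [Γpaper, Subgroup.closure_le]
  rintro _ (rfl | rfl | rfl | rfl | rfl | rfl | rfl | rfl)
  · exact ⟨(d⁻¹ * h) ^ 3, by simp [MonoidHom.mem_ker, cd, ch, three], by rw [map_pow, hg]⟩
  · exact ⟨d, cd, hd⟩
  · refine ⟨(e⁻¹ * h⁻¹) ^ 3, by simp [MonoidHom.mem_ker, ce, ch, three], ?_⟩
    rw [map_pow, hf, conj_pow]
  · exact ⟨e, ce, he⟩
  · exact ⟨(d⁻¹ * h) * d * (d⁻¹ * h)⁻¹, by simp [MonoidHom.mem_ker, cd],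
      by rw [map_mul, map_mul, map_inv, hg, hd]⟩
  · exact ⟨(d⁻¹ * h) * e * (d⁻¹ * h)⁻¹, by simp [MonoidHom.mem_ker, cd, ce],
      by rw [map_mul, map_mul, map_inv, hg, he]⟩
  · exact ⟨(d⁻¹ * h) ^ 2 * d * ((d⁻¹ * h) ^ 2)⁻¹, by simp [MonoidHom.mem_ker, cd],
      by rw [map_mul, map_mul, map_inv, map_pow, hg, hd]⟩
  · exact ⟨(d⁻¹ * h) ^ 2 * e * ((d⁻¹ * h) ^ 2)⁻¹, by simp [MonoidHom.mem_ker, cd, ce],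
      by rw [map_mul, map_mul, map_inv, map_pow, hg, he]⟩

theorem charThree_eq_one_of_mem {w : FreeGroup (Fin 3)}
    (hw : FreeGroup.lift freeGen w ∈ Γpaper) : charThree w = 1 := by
  obtain ⟨v, hv, hvw⟩ := Γpaper_le_map_ker_charThree hw
  rwa [← freeGen_injective hvw]

theorem γ_pow (m : ℕ) : (γ ^ m).1 = !![1, 5 * (m : ℤ); 0, 1] := by
  induction m with
  | zero => simp [Matrix.one_fin_two]
  | succ m ih =>
    rw [pow_succ, coe_mul, ih]
    simp [γ]
    ring

theorem δ_pow (m : ℕ) : (δ ^ m).1 = !![1, 0; -(m : ℤ), 1] := by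
  induction m with
  | zero => simp [Matrix.one_fin_two]
  | succ m ih =>
    rw [pow_succ, coe_mul, ih]
    simp [δ]
    ring

/-- The braid relation between unipotents holds modulo `N` at an idempotent parameter. -/
theorem braid_mem_ker {N m : ℕ} (hm : ((5 * m : ℕ) : ZMod N) * (5 * m : ℕ) = (5 * m : ℕ)) :
    (γ ^ m * δ ^ (5 * m) * γ ^ m)⁻¹ * (δ ^ (5 * m) * γ ^ m * δ ^ (5 * m)) ∈
      (Matrix.SpecialLinearGroup.map (n := Fin 2) (Int.castRingHom (ZMod N))).ker := by
  rw [← MonoidHom.eq_iff]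
  apply Subtype.ext
  simp only [map_mul, coe_mul, Matrix.SpecialLinearGroup.map_apply_coe, γ_pow, δ_pow]
  push_cast at hm
  ext i j
  fin_cases i <;> fin_cases j <;> simp [Matrix.mul_apply, Fin.sum_univ_two] <;> grind

/-- A multiple of five that is idempotent modulo `N` and is `1` modulo `3`. -/
theorem exists_idempotent {N : ℕ} (hN : 0 < N) :
    ∃ m : ℕ, ((5 * m : ℕ) : ZMod N) * (5 * m : ℕ) = (5 * m : ℕ) ∧ ((5 * m : ℕ) : ZMod 3) = 1 := by
  obtain ⟨k, M, hM, rfl⟩ := Nat.exists_eq_pow_mul_and_not_dvd hN.ne' 3 (by norm_num)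
  have hcop : Nat.Coprime (3 ^ (k + 1)) (5 * M) :=
    Nat.Coprime.pow_left _ (Nat.Coprime.mul_right (by norm_num)
      ((Nat.Prime.coprime_iff_not_dvd Nat.prime_three).2 hM))
  obtain ⟨e, he1, he2⟩ := Nat.chineseRemainder hcop 1 0
  obtain ⟨c, rfl⟩ := (Nat.modEq_zero_iff_dvd.1 he2)
  have h1 : ((3 ^ (k + 1) : ℕ) : ℤ) ∣ ((5 * M * c : ℕ) : ℤ) - 1 := by
    simpa using (Nat.modEq_iff_dvd.1 he1.symm)
  refine ⟨M * c, ?_, ?_⟩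
  · have h3 : ((3 ^ k * M : ℕ) : ℤ) ∣ (5 * M * c : ℕ) * (5 * M * c : ℕ) - (5 * M * c : ℕ) := by
      obtain ⟨q, hq⟩ := h1
      refine ⟨3 * q * 5 * c, ?_⟩
      push_cast at hq ⊢
      linear_combination 5 * M * c * hq
    have := (ZMod.intCast_zmod_eq_zero_iff_dvd _ _).2 h3
    push_cast at this ⊢
    linear_combination this
  · have h3 : ((3 : ℕ) : ℤ) ∣ ((5 * M * c : ℕ) : ℤ) - 1 :=
      dvd_trans (Int.natCast_dvd_natCast.2 (dvd_pow_self 3 k.succ_ne_zero)) h1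
    have := (ZMod.intCast_zmod_eq_zero_iff_dvd _ _).2 h3
    push_cast at this ⊢
    linear_combination this

theorem not_ker_le_Γpaper {N : ℕ} (hN : 0 < N) :
    ¬ ((Matrix.SpecialLinearGroup.map (n := Fin 2) (Int.castRingHom (ZMod N))).ker ≤ Γpaper) := by
  intro hle
  obtain ⟨m, hm, hm3⟩ := exists_idempotent hN
  let d : FreeGroup (Fin 3) := .of 0
  let g : FreeGroup (Fin 3) := d⁻¹ * .of 2
  have hg : FreeGroup.lift freeGen g = γ := by simp [d, g, freeGen]
  have hd : FreeGroup.lift freeGen d = δ := by simp [d, freeGen]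
  have cd : charThree d = 1 := by simp [d, charThree]
  have cg : charThree g = Multiplicative.ofAdd 1 := by simp [g, d, charThree]
  have key : charThree
      ((g ^ m * d ^ (5 * m) * g ^ m)⁻¹ * (d ^ (5 * m) * g ^ m * d ^ (5 * m))) = 1 := by
    apply charThree_eq_one_of_mem
    simp only [map_mul, map_inv, map_pow, hg, hd]
    exact hle (braid_mem_ker hm)
  have hm0 : (m : ZMod 3) = 0 := by
    simp only [map_mul, map_inv, map_pow, cd, cg, one_pow, one_mul, mul_one] at key
    simpa [← ofAdd_nsmul] using key
  rw [Nat.cast_mul, hm0, mul_zero] at hm3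
  exact absurd hm3 (by decide)

/-- Γ is a noncongruence subgroup of SL₂(ℤ): it has finite index, but contains no
principal congruence subgroup Γ(N) = ker(SL₂(ℤ) → SL₂(ℤ/Nℤ)). -/
theorem stmt_15 :
    Γpaper.FiniteIndex ∧
    ∀ N : ℕ, 0 < N →
      ¬ ((Matrix.SpecialLinearGroup.map (n := Fin 2) (Int.castRingHom (ZMod N))).ker ≤ Γpaper) :=
  ⟨finiteIndex_Γpaper, fun _ hN => not_ker_le_Γpaper hN⟩
end

section
/- Let χ₃ be the Dirichlet character modulo 5 determined by χ₃(2) = i (a character of order 4), and let χ₄ = χ₃³ be its complex conjugate. Then the Dirichlet L-values at s = 3 are given by L(3, χ₃) = (τ(χ₃)/(2i)) · (−1/2) · (2π/5)³ · (−1/3) · (6/5) · (2 − i) and L(3, χ₄) = (τ(χ₄)/(2i)) · (−1/2) · (2π/5)³ · (−1/3) · (6/5) · (2 + i), where τ(χ) = Σ_{a=1}^{4} χ(a) e^{2πia/5} is the Gauss sum of χ. -/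
open Complex

/-- The Gauss sum τ(χ) = Σ_{a mod 5} χ(a) e^{2πia/5} of a Dirichlet character mod 5. -/
noncomputable def gaussSum5 (χ : DirichletCharacter ℂ 5) : ℂ :=
  ∑ a : ZMod 5, χ a * Complex.exp (2 * Real.pi * Complex.I * (a.val : ℂ) / 5)

lemma bernoulliFun_three (x : ℝ) : bernoulliFun 3 x = x ^ 3 - 3 / 2 * x ^ 2 + x / 2 := by
  have h3 : bernoulli 3 = 0 := bernoulli_eq_zero_of_odd (by decide) (by norm_num)
  simp [bernoulliFun, Polynomial.bernoulli_def, Finset.sum_range_succ, h3, Nat.choose]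
  ring

lemma hasSum_sin_div_cube {x : ℝ} (hx : x ∈ Set.Icc (0 : ℝ) 1) :
    HasSum (fun n : ℕ => 1 / (n : ℝ) ^ 3 * Real.sin (2 * Real.pi * n * x))
      ((2 * Real.pi) ^ 3 / 12 * (x ^ 3 - 3 / 2 * x ^ 2 + x / 2)) := by
  convert! hasSum_one_div_nat_pow_mul_sin one_ne_zero hx using 1
  rw [← bernoulliFun_three, bernoulliFun]
  norm_num [Nat.factorial]
  left
  ring

lemma sin_sq_two_pi_div_five_add :
    Real.sin (2 * Real.pi / 5) ^ 2 + Real.sin (4 * Real.pi / 5) ^ 2 = 5 / 4 := by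
  have h4 : Real.sin (4 * Real.pi / 5) = Real.sin (Real.pi / 5) := by
    rw [← Real.sin_pi_sub]; congr 1; ring
  have h2 : Real.cos (2 * Real.pi / 5) = 2 * Real.cos (Real.pi / 5) ^ 2 - 1 := by
    rw [← Real.cos_two_mul]; congr 1; ring
  have h5 : Real.sqrt 5 ^ 2 = 5 := Real.sq_sqrt (by norm_num)
  rw [h4, Real.sin_sq, Real.sin_sq, h2, Real.cos_pi_div_five]
  grind

lemma sin_two_pi_mul_div_five_mod (n a : ℕ) :
    Real.sin (2 * Real.pi * n * (a / 5)) = Real.sin (2 * Real.pi * (n % 5 : ℕ) * (a / 5)) := by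
  have h : (n : ℝ) = 5 * (n / 5 : ℕ) + (n % 5 : ℕ) := by
    exact_mod_cast (Nat.div_add_mod n 5).symm
  rw [← Real.sin_add_nat_mul_two_pi (2 * Real.pi * (n % 5 : ℕ) * (a / 5)) ((n / 5) * a)]
  congr 1
  rw [h]
  push_cast
  ring

lemma apply_zero_mod_five (χ : DirichletCharacter ℂ 5) : χ 0 = 0 :=
  χ.map_nonunit (by decide)

section

variable {χ : DirichletCharacter ℂ 5} {c : ℂ}

lemma apply_three_of_apply_two (h2 : χ 2 = c) : χ 3 = c ^ 3 := by
  rw [← h2, ← map_pow]; rfl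

lemma apply_four_of_apply_two (h2 : χ 2 = c) : χ 4 = c ^ 2 := by
  rw [← h2, ← map_pow]; rfl

lemma gaussSum5_eq (h2 : χ 2 = c) (hc : c ^ 2 = -1) :
    gaussSum5 χ =
      2 * I * (Real.sin (2 * Real.pi / 5) + c * Real.sin (4 * Real.pi / 5)) := by
  have hexp (a : ℕ) : exp (2 * Real.pi * I * a / 5) - exp (2 * Real.pi * I * (5 - a) / 5) =
      2 * I * (Real.sin (2 * Real.pi * a / 5) : ℝ) := by
    have h : (2 * Real.pi * I * (5 - a) / 5 : ℂ) =
        -(2 * Real.pi * a / 5 : ℂ) * I + 2 * Real.pi * I := by ring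
    rw [h, exp_periodic, show (2 * Real.pi * I * a / 5 : ℂ) = (2 * Real.pi * a / 5 : ℂ) * I by ring]
    push_cast
    rw [sin]
    linear_combination (exp ((2 * Real.pi * a / 5) * I) - exp (-(2 * Real.pi * a / 5) * I)) * I_sq
  have e1 := hexp 1
  have e2 := hexp 2
  have hsum : gaussSum5 χ = χ 0 * exp (2 * Real.pi * I * (0 : ℕ) / 5) +
      χ 1 * exp (2 * Real.pi * I * (1 : ℕ) / 5) + χ 2 * exp (2 * Real.pi * I * (2 : ℕ) / 5) +
      χ 3 * exp (2 * Real.pi * I * (3 : ℕ) / 5) + χ 4 * exp (2 * Real.pi * I * (4 : ℕ) / 5) :=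
    Fin.sum_univ_five _
  rw [hsum, apply_zero_mod_five χ, map_one, h2, apply_three_of_apply_two h2, apply_four_of_apply_two h2,
    show c ^ 3 = -c by linear_combination c * hc, hc]
  norm_num at e1 e2 ⊢
  rw [show (4 * Real.pi / 5 : ℂ) = 2 * Real.pi * 2 / 5 by ring]
  linear_combination e1 + c * e2

lemma apply_eq_gaussSum5_mul_sin (h2 : χ 2 = c) (hc : c ^ 2 = -1) (n : ℕ) :
    χ (n : ZMod 5) = -(2 * I * gaussSum5 χ / 5) *
      (Real.sin (2 * Real.pi * n * ((1 : ℕ) / 5)) -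
        c * Real.sin (2 * Real.pi * n * ((2 : ℕ) / 5))) := by
  have hs : (Real.sin (2 * Real.pi / 5) : ℂ) ^ 2 + (Real.sin (4 * Real.pi / 5) : ℂ) ^ 2 = 5 / 4 := by
    simpa using congrArg ofReal sin_sq_two_pi_div_five_add
  have h6 : Real.sin (6 * Real.pi / 5) = -Real.sin (4 * Real.pi / 5) := by
    rw [← Real.sin_neg, ← Real.sin_add_two_pi (-(4 * Real.pi / 5))]; congr 1; ring
  have h8 : Real.sin (8 * Real.pi / 5) = -Real.sin (2 * Real.pi / 5) := by
    rw [← Real.sin_neg, ← Real.sin_add_two_pi (-(2 * Real.pi / 5))]; congr 1; ring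
  have h12 : Real.sin (12 * Real.pi / 5) = Real.sin (2 * Real.pi / 5) := by
    rw [← Real.sin_add_two_pi (2 * Real.pi / 5)]; congr 1; ring
  have h16 : Real.sin (16 * Real.pi / 5) = -Real.sin (4 * Real.pi / 5) := by
    rw [← h6, ← Real.sin_add_two_pi (6 * Real.pi / 5)]; congr 1; ring
  rw [gaussSum5_eq h2 hc, sin_two_pi_mul_div_five_mod n 1, sin_two_pi_mul_div_five_mod n 2,
    ← ZMod.natCast_mod]
  have hlt : n % 5 < 5 := Nat.mod_lt _ (by norm_num)
  generalize n % 5 = m at hlt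
  generalize hS1 : Real.sin (2 * Real.pi / 5) = s at *
  generalize hS2 : Real.sin (4 * Real.pi / 5) = t at *
  have hval (k a : ℕ) : Real.sin (2 * Real.pi * k * (a / 5)) =
      Real.sin (((2 * k * a : ℕ) : ℝ) * Real.pi / 5) := by
    congr 1; push_cast; ring
  rw [hval, hval]
  interval_cases m
  · simp [apply_zero_mod_five χ]
  · norm_num [hS1, hS2]
    grind [I_sq]
  · norm_num [hS1, hS2, h2, h8]
    grind [I_sq]
  · norm_num [hS1, hS2, apply_three_of_apply_two h2, h6, h12]
    grind [I_sq]
  · norm_num [hS1, hS2, apply_four_of_apply_two h2, h8, h16]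
    grind [I_sq]

lemma LSeries_three_eq_gaussSum5 (h2 : χ 2 = c) (hc : c ^ 2 = -1) :
    LSeries (fun n => χ (n : ZMod 5)) 3 =
      (gaussSum5 χ / (2 * I)) * (-(1 / 2 : ℂ)) * ((2 * (Real.pi : ℂ) / 5) ^ 3) *
        (-(1 / 3 : ℂ)) * (6 / 5 : ℂ) * (2 - c) := by
  apply LSeriesHasSum.LSeries_eq
  have s1 := (hasSum_ofReal.mpr
    (hasSum_sin_div_cube (x := (1 : ℕ) / 5) (by norm_num [Set.mem_Icc])))
  have s2 := (hasSum_ofReal.mpr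
    (hasSum_sin_div_cube (x := (2 : ℕ) / 5) (by norm_num [Set.mem_Icc])))
  have s := (s1.sub (s2.mul_left c)).mul_left (-(2 * I * gaussSum5 χ / 5))
  rw [LSeriesHasSum]
  convert! s using 1
  · ext n
    rcases eq_or_ne n 0 with rfl | hn
    · simp
    · rw [LSeries.term_of_ne_zero hn, apply_eq_gaussSum5_mul_sin h2 hc n,
        show (n : ℂ) ^ (3 : ℂ) = (n : ℂ) ^ 3 by exact_mod_cast cpow_natCast (n : ℂ) 3]
      push_cast
      ring
  · rw [← div_div, div_eq_mul_inv _ I, inv_I]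
    push_cast
    ring

end

/-- Explicit values of L(3,χ₃) and L(3,χ₄), where χ₃ is the Dirichlet character mod 5
with χ₃(2) = i and χ₄ = χ₃³, and L(s,χ) = Σ_{n≥1} χ(n) n^{-s}. -/
theorem stmt_19 (χ₃ : DirichletCharacter ℂ 5) (h2 : χ₃ 2 = Complex.I) :
    LSeries (fun n => χ₃ (n : ZMod 5)) 3 =
      (gaussSum5 χ₃ / (2 * Complex.I)) * (-(1 / 2 : ℂ)) * ((2 * (Real.pi : ℂ) / 5) ^ 3) *
        (-(1 / 3 : ℂ)) * (6 / 5 : ℂ) * (2 - Complex.I) ∧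
    LSeries (fun n => (χ₃ ^ 3) (n : ZMod 5)) 3 =
      (gaussSum5 (χ₃ ^ 3) / (2 * Complex.I)) * (-(1 / 2 : ℂ)) *
        ((2 * (Real.pi : ℂ) / 5) ^ 3) * (-(1 / 3 : ℂ)) * (6 / 5 : ℂ) * (2 + Complex.I) := by
  have h2' : (χ₃ ^ 3) 2 = -I := by
    rw [MulChar.pow_apply' _ (by norm_num), h2, I_pow_three]
  refine ⟨LSeries_three_eq_gaussSum5 h2 I_sq, ?_⟩
  rw [LSeries_three_eq_gaussSum5 h2' (by rw [neg_sq, I_sq]), sub_neg_eq_add]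
end
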